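/- For every n ≥ 0 and every defect-0 β-pair (A,B) of rank n, the pair Θ(A,B) belongs to Ỹ_{2n} and has defect 1; moreover Θ is compatible with shifts (Θ applied to the 1-shift of (A,B) equals the 1-shift of Θ(A,B) in the 𝕐-family) and induces a well-defined bijection from 𝕍_n^0 onto 𝕐_{2n}^1. -/

import Mathlib

namespace CSpaper

/-- The rank of a β-set: the sum of its elements minus `choose (card) 2`. -/
def bRank (B : Finset ℕ) : ℤ :=
  (∑ b ∈ B, (b : ℤ)) - (B.card.choose 2 : ℤ)

/-- The `k`-th shift of a β-set: `{0,…,k-1} ∪ {b+k : b ∈ B}`. -/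
def bShift (k : ℕ) (B : Finset ℕ) : Finset ℕ :=
  Finset.range k ∪ B.image (· + k)

/-- Shift-equivalence of β-sets. -/
def sEquiv (A B : Finset ℕ) : Prop :=
  ∃ k, bShift k A = B ∨ A = bShift k B

/-- A β-pair: an ordered pair of β-sets. -/
abbrev BPair := Finset ℕ × Finset ℕ

/-- The defect of a β-pair. -/
def pDefect (Λ : BPair) : ℤ := (Λ.1.card : ℤ) - (Λ.2.card : ℤ)

/-- The rank of a β-pair: `rk A + rk B + ⌊(d/2)²⌋`. -/
def pRank (Λ : BPair) : ℤ := bRank Λ.1 + bRank Λ.2 + pDefect Λ ^ 2 / 4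

/-- The `k`-th shift of a β-pair. -/
def pShift (k : ℕ) (Λ : BPair) : BPair := (bShift k Λ.1, bShift k Λ.2)

/-- Shift-equivalence of β-pairs: one is a shift of the other. -/
def pEquiv (Λ Ξ : BPair) : Prop := ∃ k, pShift k Λ = Ξ ∨ Λ = pShift k Ξ

/-- `Λ` is a representative of a symbol in `𝕍_N^d`. -/
def inV (N d : ℤ) (Λ : BPair) : Prop := pRank Λ = N ∧ pDefect Λ = d

/-- The `i`-th smallest element of a finite set of naturals (0-indexed). -/
def nthEl (A : Finset ℕ) (i : ℕ) : ℕ := (A.sort (· ≤ ·)).getD i 0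

/-- The operation `A ⊙ B = {a_1+b_1, a_2+b_2-1, …, a_s+b_s-(s-1)}` (0-indexed:
`a_i + b_i - i`). -/
def odot (A B : Finset ℕ) : Finset ℕ :=
  (Finset.range A.card).image fun i => nthEl A i + nthEl B i - i

/-- Dominance order `B ⊴ A`: every tail sum of `B` is at most the corresponding
tail sum of `A`. -/
def domLE (B A : Finset ℕ) : Prop :=
  ∀ k, ∑ i ∈ Finset.Ico k B.card, nthEl B i ≤ ∑ i ∈ Finset.Ico k A.card, nthEl A i

/-- No two consecutive integers. -/
def noConsec (S : Finset ℕ) : Prop := ∀ x ∈ S, x + 1 ∉ S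

/-- `{0,2,…,2k-2} ∪ {x+2k : x ∈ S}`. -/
def evShift (k : ℕ) (S : Finset ℕ) : Finset ℕ :=
  (Finset.range k).image (fun i => 2 * i) ∪ S.image (· + 2 * k)

/-- `{1,3,…,2k-1} ∪ {y+2k : y ∈ S}`. -/
def odShift (k : ℕ) (S : Finset ℕ) : Finset ℕ :=
  (Finset.range k).image (fun i => 2 * i + 1) ∪ S.image (· + 2 * k)

/-- The `k`-th shift in the 𝕐-family. -/
def yShift (k : ℕ) (P : BPair) : BPair := (evShift k P.1, odShift k P.2)

/-- The `k`-th shift in the 𝕏-family. -/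
def xShift (k : ℕ) (P : BPair) : BPair := (evShift k P.1, evShift k P.2)

/-- Shift-equivalence in the 𝕐-family. -/
def yEquiv (P Q : BPair) : Prop := ∃ k, yShift k P = Q ∨ P = yShift k Q

/-- Shift-equivalence in the 𝕏-family (unordered pairs, so swaps are allowed). -/
def xEquiv (P Q : BPair) : Prop :=
  ∃ k, xShift k P = Q ∨ xShift k P = Q.swap ∨ P = xShift k Q ∨ P.swap = xShift k Q

/-- Membership in `Ỹ_N`. -/
def inYtilde (N : ℤ) (P : BPair) : Prop :=
  (∀ y ∈ P.2, 0 < y) ∧ Odd (P.1.card + P.2.card) ∧ noConsec P.1 ∧ noConsec P.2 ∧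
    2 * ((∑ x ∈ P.1, (x : ℤ)) + ∑ y ∈ P.2, (y : ℤ)) =
      N + ((P.1.card + P.2.card : ℕ) : ℤ) * (((P.1.card + P.2.card : ℕ) : ℤ) - 1)

/-- The defect in the 𝕐-family: `|X| - |Y|`. -/
def yDefect (P : BPair) : ℤ := (P.1.card : ℤ) - (P.2.card : ℤ)

/-- Membership in `X̃_N`. -/
def inXtilde (N : ℤ) (P : BPair) : Prop :=
  noConsec P.1 ∧ noConsec P.2 ∧
    2 * ((∑ x ∈ P.1, (x : ℤ)) + ∑ y ∈ P.2, (y : ℤ)) =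
      N + (((P.1.card + P.2.card : ℕ) : ℤ) - 1) ^ 2 - 1

/-- The defect in the 𝕏-family: `||A| - |B||`. -/
def xDefect (P : BPair) : ℤ := |(P.1.card : ℤ) - (P.2.card : ℤ)|

/-- The map `Θ(A,B) = ({0, a_1+2, …, a_s+s+1}, {b_1+1, …, b_s+s})`. -/
def theta (Λ : BPair) : BPair :=
  (insert 0 ((Finset.range Λ.1.card).image fun i => nthEl Λ.1 i + i + 2),
   (Finset.range Λ.2.card).image fun i => nthEl Λ.2 i + i + 1)

/-- The map `Θ'(A,B) = ({0, a_1+2, …, a_s+s+1}, {b_1, …, b_s+s-1})`. -/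
def theta' (Λ : BPair) : BPair :=
  (insert 0 ((Finset.range Λ.1.card).image fun i => nthEl Λ.1 i + i + 2),
   (Finset.range Λ.2.card).image fun i => nthEl Λ.2 i + i)

/-- The map `Θ̄(A,B) = ({a_1, …, a_s+s-1}, {b_1, …, b_s+s-1})`. -/
def thetaBar (Λ : BPair) : BPair :=
  ((Finset.range Λ.1.card).image fun i => nthEl Λ.1 i + i,
   (Finset.range Λ.2.card).image fun i => nthEl Λ.2 i + i)

/-- `ᵀΘ(A,B) = Θ(B,A)`. -/
def thetaT (Λ : BPair) : BPair := theta (Λ.2, Λ.1)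

/-- `Π^d` for `d ≥ 1`: adjoin `{0,2,…,2d-4}` to the first row and add `2d-2`
to its entries. -/
def piPos (d : ℕ) (P : BPair) : BPair := (evShift (d - 1) P.1, P.2)

/-- `Π^d` for `d = -e ≤ -1`: adjoin `{1,3,…,2e+1}` to the second row and add
`2e+2` to its entries. -/
def piNeg (e : ℕ) (P : BPair) : BPair := (P.1, odShift (e + 1) P.2)

/-- `Δ_B^t = Π^{2t+1} ∘ Θ'`. -/
def deltaB (t : ℕ) (Λ : BPair) : BPair := piPos (2 * t + 1) (theta' Λ)

/-- `Δ_C^t = Π^{4t+1} ∘ Θ`. -/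
def deltaC (t : ℕ) (Λ : BPair) : BPair := piPos (4 * t + 1) (theta Λ)

/-- `Δ_{C'}^t = Π^{1-4t} ∘ ᵀΘ` (for `t ≥ 1`). -/
def deltaC' (t : ℕ) (Λ : BPair) : BPair := piNeg (4 * t - 1) (thetaT Λ)

/-- `Δ_D^t = Π^{4t} ∘ Θ'` (for `t ≥ 1`). -/
def deltaD (t : ℕ) (Λ : BPair) : BPair := piPos (4 * t) (theta' Λ)

/-- `Δ_D^0 = Θ̄`. -/
def deltaD0 (Λ : BPair) : BPair := thetaBar Λ

/-- All entries of a pair (with multiplicity) in weakly increasing order. -/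
def entries (P : BPair) : List ℕ := (P.1.val + P.2.val).sort (· ≤ ·)

/-- `Σ_j (len-1-j) ⬝ (L[j] - ref j)`, the common shape of `a`, `b` and `σ`. -/
def wsum (L : List ℕ) (ref : ℕ → ℕ) : ℤ :=
  ∑ j ∈ Finset.range L.length,
    ((L.length - 1 - j : ℕ) : ℤ) * ((L.getD j 0 : ℤ) - (ref j : ℤ))

/-- Lusztig's a-function (reference sequence `0,0,1,1,…`). -/
def aFun (P : BPair) : ℤ := wsum (entries P) (fun j => j / 2)

/-- Lusztig's b-function with the 𝕏-reference sequence `0,0,2,2,…`. -/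
def bX (P : BPair) : ℤ := wsum (entries P) (fun j => 2 * (j / 2))

/-- Lusztig's b-function with the 𝕐-reference sequence `0,1,2,…`. -/
def bY (P : BPair) : ℤ := wsum (entries P) (fun j => j)

/-- `σ(Λ) = Σ (2k-i)·x_i`. -/
def sigmaFun (P : BPair) : ℤ := wsum (entries P) (fun _ => 0)

/-- Entrywise sum of two rows (of equal size), sorted positions added. -/
def addRows (X X' : Finset ℕ) : Finset ℕ :=
  (Finset.range X.card).image fun i => nthEl X i + nthEl X' i

/-- `Λ ⊕ Ξ` in the types B and D cases. -/
def oplus (Λ Ξ : BPair) : BPair := (addRows Λ.1 Ξ.1, addRows Λ.2 Ξ.2)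

/-- `Λ ⊕ Ξ` in the type C case. -/
def oplusC (Λ Ξ : BPair) : BPair :=
  (insert (nthEl Ξ.1 0)
      ((Finset.range Λ.1.card).image fun i => nthEl Λ.1 i + nthEl Ξ.1 (i + 1) + 1),
   (Finset.range Λ.2.card).image fun j => nthEl Λ.2 j + nthEl Ξ.2 j + 1)

/-- `Λ ⊞ Ξ`: the twisted combination in type D. -/
def boxplus (Λ Ξ : BPair) : BPair := (addRows Λ.2 Ξ.1, addRows Λ.1 Ξ.2)

/-- Similarity of β-pairs: after shifts, the row unions and row intersections
coincide. -/
def pSimilar (Λ Ξ : BPair) : Prop :=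
  ∃ j k, (pShift j Λ).1 ∪ (pShift j Λ).2 = (pShift k Ξ).1 ∪ (pShift k Ξ).2 ∧
    (pShift j Λ).1 ∩ (pShift j Λ).2 = (pShift k Ξ).1 ∩ (pShift k Ξ).2

/-- Similarity in the 𝕏-family: after 𝕏-shifts, the row unions and
intersections coincide. -/
def xSimilar (P Q : BPair) : Prop :=
  ∃ j k, (xShift j P).1 ∪ (xShift j P).2 = (xShift k Q).1 ∪ (xShift k Q).2 ∧
    (xShift j P).1 ∩ (xShift j P).2 = (xShift k Q).1 ∩ (xShift k Q).2

/-- A β-pair is reduced if it is not a proper shift, i.e. `0` does not lie in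
both rows; each shift-equivalence class has a unique reduced representative. -/
def reduced (Λ : BPair) : Prop := ¬ (0 ∈ Λ.1 ∧ 0 ∈ Λ.2)

/-- `a(Λ) + a(Ξ) = b(Λ⊕Ξ)`, computed (as in the paper) on shift-representatives
with matching row sizes. -/
def minimalPair (Λ Ξ : BPair) : Prop :=
  ∃ Λ' Ξ', pEquiv Λ Λ' ∧ pEquiv Ξ Ξ' ∧ Λ'.1.card = Ξ'.1.card ∧
    Λ'.2.card = Ξ'.2.card ∧ aFun Λ' + aFun Ξ' = bX (oplus Λ' Ξ')

/-- The generating relation `i ≈ i+1` whenever `c_i = c_{i+1}` or `d_i = d_{i+1}`. -/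
def linkRel (n : ℕ) (c d : ℕ → ℕ) (i j : Fin n) : Prop :=
  (j : ℕ) = (i : ℕ) + 1 ∧ (c i = c j ∨ d i = d j)

/-- The equivalence relation generated by `linkRel`. -/
def idxSetoid (n : ℕ) (c d : ℕ → ℕ) : Setoid (Fin n) :=
  ⟨Relation.EqvGen (linkRel n c d), Relation.EqvGen.is_equivalence _⟩

/-- A degenerate equivalence class: `{i, i+1}` with `c_i = c_{i+1}` and
`d_i = d_{i+1}`. -/
def degenClass (n : ℕ) (c d : ℕ → ℕ) (Q : Quotient (idxSetoid n c d)) : Prop :=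
  ∃ i j : Fin n, (j : ℕ) = (i : ℕ) + 1 ∧ c i = c j ∧ d i = d j ∧
    Q = Quotient.mk (idxSetoid n c d) i ∧
    ∀ m : Fin n, Quotient.mk (idxSetoid n c d) m = Q → m = i ∨ m = j

/-- The number `ℓ` of non-degenerate equivalence classes. -/
noncomputable def ellCount (n : ℕ) (c d : ℕ → ℕ) : ℕ :=
  Nat.card {Q : Quotient (idxSetoid n c d) // ¬ degenClass n c d Q}

/-- `Ξ` is obtained from `Λ` by decreasing a single entry by `1`, the result
again being a β-pair. -/
def stepDown (Λ Ξ : BPair) : Prop :=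
  (∃ x ∈ Λ.1, 0 < x ∧ x - 1 ∉ Λ.1 ∧ Ξ = (insert (x - 1) (Λ.1.erase x), Λ.2)) ∨
  (∃ x ∈ Λ.2, 0 < x ∧ x - 1 ∉ Λ.2 ∧ Ξ = (Λ.1, insert (x - 1) (Λ.2.erase x)))

/-- The number of elements of `A` below `a`. -/
def rankIn (A : Finset ℕ) (a : ℕ) : ℕ := (A.filter (· < a)).card

/-- The set `{a_1, a_2 + 1, …, a_s + s - 1}`. -/
def spread (A : Finset ℕ) : Finset ℕ := A.image fun a => a + rankIn A a

/-- The set `{x_1, x_2 - 1, …, x_s - s + 1}`, inverse to `spread`. -/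
def unspread (X : Finset ℕ) : Finset ℕ := X.image fun x => x - rankIn X x

lemma rankIn_mono (A : Finset ℕ) : Monotone (rankIn A) := fun _ _ h =>
  Finset.card_le_card fun _ hx => by
    simp only [Finset.mem_filter] at hx ⊢
    exact ⟨hx.1, hx.2.trans_le h⟩

lemma add_rankIn_strictMono (A : Finset ℕ) : StrictMono fun a => a + rankIn A a :=
  strictMono_id.add_monotone (rankIn_mono A)

lemma rankIn_image {A : Finset ℕ} {f : ℕ → ℕ} (hf : StrictMonoOn f A) {a : ℕ} (ha : a ∈ A) :
    rankIn (A.image f) (f a) = rankIn A a := by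
  have h : (A.image f).filter (· < f a) = (A.filter (· < a)).image f := by
    ext y
    simp only [Finset.mem_filter, Finset.mem_image]
    constructor
    · rintro ⟨⟨b, hb, rfl⟩, hy⟩
      exact ⟨b, ⟨hb, (hf.lt_iff_lt hb ha).1 hy⟩, rfl⟩
    · rintro ⟨b, ⟨hb, hy⟩, rfl⟩
      exact ⟨⟨b, hb, rfl⟩, (hf.lt_iff_lt hb ha).2 hy⟩
  rw [rankIn, h, Finset.card_image_of_injOn, rankIn]
  exact hf.injOn.mono fun b hb => (Finset.mem_filter.1 hb).1

lemma unspread_spread (A : Finset ℕ) : unspread (spread A) = A := by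
  have h : ∀ a ∈ A, a + rankIn A a - rankIn (spread A) (a + rankIn A a) = a := fun a ha => by
    have := rankIn_image ((add_rankIn_strictMono A).strictMonoOn A) ha
    simp only [spread]
    omega
  rw [unspread]
  nth_rw 2 [spread]
  rw [Finset.image_image]
  exact (Finset.image_congr h).trans Finset.image_id

lemma spread_injective : Function.Injective spread :=
  Function.LeftInverse.injective unspread_spread

lemma rankIn_lt {X : Finset ℕ} {x y : ℕ} (hx : x ∈ X) (h : x < y) :
    rankIn X x < rankIn X y := by
  refine Finset.card_lt_card (Finset.ssubset_iff_of_subset ?_ |>.2 ⟨x, ?_, ?_⟩)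
  · intro z hz
    simp only [Finset.mem_filter] at hz ⊢
    exact ⟨hz.1, hz.2.trans h⟩
  · simp [hx, h]
  · simp

lemma rankIn_add_le (X : Finset ℕ) (x k : ℕ) : rankIn X (x + k) ≤ rankIn X x + k := by
  have h : X.filter (· < x + k) ⊆ X.filter (· < x) ∪ Finset.Ico x (x + k) := by
    intro z hz
    simp only [Finset.mem_filter, Finset.mem_union, Finset.mem_Ico] at hz ⊢
    have := hz.1
    by_cases h : z < x
    · exact Or.inl ⟨this, h⟩
    · exact Or.inr ⟨by omega, hz.2⟩
  have h₂ := (Finset.card_le_card h).trans (Finset.card_union_le _ _)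
  simpa [rankIn] using h₂

lemma rankIn_le (X : Finset ℕ) (x : ℕ) : rankIn X x ≤ x := by
  simpa [rankIn] using rankIn_add_le X 0 x

lemma rankIn_succ_succ_le {X : Finset ℕ} (hX : noConsec X) {x : ℕ} (hx : x ∈ X) :
    rankIn X (x + 2) ≤ rankIn X x + 1 := by
  have h : X.filter (· < x + 2) ⊆ insert x (X.filter (· < x)) := by
    intro z hz
    simp only [Finset.mem_filter, Finset.mem_insert] at hz ⊢
    have h₁ : z ≠ x + 1 := fun h => hX x hx (h ▸ hz.1)
    by_cases h : z = x
    · exact Or.inl h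
    · exact Or.inr ⟨hz.1, by omega⟩
  exact (Finset.card_le_card h).trans (Finset.card_insert_le _ _)

lemma sub_rankIn_strictMonoOn {X : Finset ℕ} (hX : noConsec X) :
    StrictMonoOn (fun x => x - rankIn X x) X := by
  intro x hx y hy hxy
  have h₁ : y ≠ x + 1 := fun h => hX x hx (h ▸ hy)
  obtain ⟨k, rfl⟩ : ∃ k, y = x + 2 + k := ⟨y - (x + 2), by omega⟩
  have h₂ := rankIn_add_le X (x + 2) k
  have h₃ := rankIn_succ_succ_le hX hx
  have h₄ := rankIn_le X x
  simp only
  omega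

lemma spread_unspread {X : Finset ℕ} (hX : noConsec X) : spread (unspread X) = X := by
  have h : ∀ x ∈ X, x - rankIn X x + rankIn (unspread X) (x - rankIn X x) = x := fun x hx => by
    have h₁ := rankIn_image (sub_rankIn_strictMonoOn hX) hx
    have h₂ := rankIn_le X x
    simp only [unspread]
    omega
  rw [spread]
  nth_rw 2 [unspread]
  rw [Finset.image_image]
  exact (Finset.image_congr h).trans Finset.image_id

lemma card_spread (A : Finset ℕ) : (spread A).card = A.card :=
  Finset.card_image_of_injective _ (add_rankIn_strictMono A).injective

lemma noConsec_spread (A : Finset ℕ) : noConsec (spread A) := by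
  intro x hx hx'
  simp only [spread, Finset.mem_image] at hx hx'
  obtain ⟨a, ha, rfl⟩ := hx
  obtain ⟨b, hb, h⟩ := hx'
  rcases lt_trichotomy a b with hab | rfl | hab
  · have := rankIn_lt ha hab
    omega
  · omega
  · have := rankIn_mono A hab.le
    omega

lemma sum_rankIn (A : Finset ℕ) : ∑ a ∈ A, rankIn A a = A.card.choose 2 := by
  induction A using Finset.induction_on_max with
  | empty => simp
  | insert m A hm ih =>
    have hmA : m ∉ A := fun h => (hm m h).false
    have h₁ : rankIn (insert m A) m = A.card := by
      rw [rankIn, Finset.filter_insert, if_neg (lt_irrefl m), Finset.filter_true_of_mem hm]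
    have h₂ : ∀ a ∈ A, rankIn (insert m A) a = rankIn A a := fun a ha => by
      rw [rankIn, Finset.filter_insert, if_neg (hm a ha).not_gt, rankIn]
    rw [Finset.sum_insert hmA, h₁, Finset.sum_congr rfl h₂, ih, Finset.card_insert_of_notMem hmA,
      Nat.choose_succ_succ' _ 1, Nat.choose_one_right]

lemma sum_spread (A : Finset ℕ) : ∑ x ∈ spread A, x = ∑ a ∈ A, a + A.card.choose 2 := by
  rw [spread, Finset.sum_image (add_rankIn_strictMono A).injective.injOn, Finset.sum_add_distrib,
    sum_rankIn]

lemma nthEl_eq_orderEmbOfFin (A : Finset ℕ) (i : Fin A.card) :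
    nthEl A i = A.orderEmbOfFin rfl i := by
  rw [nthEl, Finset.orderEmbOfFin_apply, List.getD_eq_getElem]
  rfl

lemma rankIn_orderEmbOfFin (A : Finset ℕ) (i : Fin A.card) :
    rankIn A (A.orderEmbOfFin rfl i) = i := by
  have h : A.filter (· < A.orderEmbOfFin rfl i) =
      (Finset.Iio i).map (A.orderEmbOfFin rfl).toEmbedding := by
    ext x
    simp only [Finset.mem_filter, Finset.mem_map, Finset.mem_Iio, RelEmbedding.coe_toEmbedding]
    constructor
    · rintro ⟨hx, hlt⟩
      obtain ⟨j, rfl⟩ : x ∈ Set.range (A.orderEmbOfFin rfl) := by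
        rwa [Finset.range_orderEmbOfFin]
      exact ⟨j, (A.orderEmbOfFin rfl).lt_iff_lt.1 hlt, rfl⟩
    · rintro ⟨j, hj, rfl⟩
      exact ⟨Finset.orderEmbOfFin_mem _ _ _, (A.orderEmbOfFin rfl).lt_iff_lt.2 hj⟩
  rw [rankIn, h, Finset.card_map, Fin.card_Iio]

lemma image_nthEl (A : Finset ℕ) (c : ℕ) :
    ((Finset.range A.card).image fun i => nthEl A i + i + c) = (spread A).image (· + c) := by
  ext x
  simp only [spread, Finset.mem_image, Finset.mem_range, exists_exists_and_eq_and]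
  constructor
  · rintro ⟨i, hi, rfl⟩
    have h₁ := nthEl_eq_orderEmbOfFin A ⟨i, hi⟩
    have h₂ := rankIn_orderEmbOfFin A ⟨i, hi⟩
    simp only at h₁ h₂
    exact ⟨_, Finset.orderEmbOfFin_mem A rfl ⟨i, hi⟩, by rw [h₁, h₂]⟩
  · rintro ⟨a, ha, rfl⟩
    obtain ⟨i, rfl⟩ : a ∈ Set.range (A.orderEmbOfFin rfl) := by
      rwa [Finset.range_orderEmbOfFin]
    exact ⟨i, i.2, by rw [nthEl_eq_orderEmbOfFin, rankIn_orderEmbOfFin]⟩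

lemma theta_eq (Λ : BPair) :
    theta Λ = (insert 0 ((spread Λ.1).image (· + 2)), (spread Λ.2).image (· + 1)) := by
  rw [theta, image_nthEl, image_nthEl]

lemma rankIn_bShift_add (k : ℕ) (A : Finset ℕ) (a : ℕ) :
    rankIn (bShift k A) (a + k) = k + rankIn A a := by
  have h : (bShift k A).filter (· < a + k) =
      (Finset.range k).disjUnion ((A.filter (· < a)).image (· + k)) (by
        rw [Finset.disjoint_left]
        grind) := by
    ext x
    simp only [bShift, Finset.mem_filter, Finset.mem_union, Finset.mem_range, Finset.mem_image,
      Finset.mem_disjUnion]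
    grind
  rw [rankIn, h, Finset.card_disjUnion, Finset.card_range,
    Finset.card_image_of_injective _ (add_left_injective k), rankIn]

lemma rankIn_bShift_of_lt {k i : ℕ} (A : Finset ℕ) (h : i < k) :
    rankIn (bShift k A) i = i := by
  have h : (bShift k A).filter (· < i) = Finset.range i := by
    ext x
    simp only [bShift, Finset.mem_filter, Finset.mem_union, Finset.mem_range, Finset.mem_image]
    grind
  rw [rankIn, h, Finset.card_range]

lemma spread_bShift (k : ℕ) (A : Finset ℕ) : spread (bShift k A) = evShift k (spread A) := by
  rw [spread]
  nth_rw 2 [bShift]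
  rw [Finset.image_union, evShift, spread, Finset.image_image, Finset.image_image]
  congr 1
  · refine Finset.image_congr fun i hi => ?_
    simp only [rankIn_bShift_of_lt A (Finset.mem_range.1 hi)]
    omega
  · refine Finset.image_congr fun a _ => ?_
    simp only [Function.comp_apply, rankIn_bShift_add]
    omega

lemma theta_pShift (k : ℕ) (Λ : BPair) : theta (pShift k Λ) = yShift k (theta Λ) := by
  simp only [theta_eq, pShift, yShift, spread_bShift, Prod.mk.injEq]
  constructor
  · ext x
    simp only [evShift, Finset.mem_insert, Finset.mem_image, Finset.mem_union, Finset.mem_range]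
    constructor
    · rintro (rfl | ⟨_, ⟨i, hi, rfl⟩ | ⟨y, hy, rfl⟩, rfl⟩)
      · rcases Nat.eq_zero_or_pos k with rfl | hk
        · exact Or.inr ⟨0, Or.inl rfl, rfl⟩
        · exact Or.inl ⟨0, hk, rfl⟩
      · rcases Nat.lt_or_ge (i + 1) k with hk | hk
        · exact Or.inl ⟨i + 1, hk, by omega⟩
        · exact Or.inr ⟨0, Or.inl rfl, by omega⟩
      · exact Or.inr ⟨y + 2, Or.inr ⟨y, hy, rfl⟩, by omega⟩
    · rintro (⟨i, hi, rfl⟩ | ⟨_, rfl | ⟨y, hy, rfl⟩, rfl⟩)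
      · rcases i with _ | i
        · exact Or.inl rfl
        · exact Or.inr ⟨2 * i, Or.inl ⟨i, by omega, rfl⟩, by omega⟩
      · rcases k with _ | k
        · exact Or.inl rfl
        · exact Or.inr ⟨2 * k, Or.inl ⟨k, by omega, rfl⟩, by omega⟩
      · exact Or.inr ⟨y + 2 * k, Or.inr ⟨y, hy, rfl⟩, by omega⟩
  · simp only [evShift, odShift, Finset.image_union, Finset.image_image]
    congr 1
    refine Finset.image_congr fun y _ => ?_
    simp only [Function.comp_apply]
    omega

lemma theta_injective : Function.Injective theta := by
  rintro ⟨A, B⟩ ⟨A', B'⟩ h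
  simp only [theta_eq, Prod.mk.injEq] at h
  obtain ⟨h₁, h₂⟩ := h
  have h₀ : ∀ X : Finset ℕ, 0 ∉ X.image (· + 2) := fun X => by simp
  have h₁ := congrArg (Finset.erase · 0) h₁
  simp only [Finset.erase_insert (h₀ _)] at h₁
  rw [spread_injective (Finset.image_injective (add_left_injective 2) h₁),
    spread_injective (Finset.image_injective (add_left_injective 1) h₂)]

lemma noConsec_image_add {X : Finset ℕ} (hX : noConsec X) (k : ℕ) :
    noConsec (X.image (· + k)) := by
  intro x hx hx'
  simp only [Finset.mem_image] at hx hx'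
  obtain ⟨y, hy, rfl⟩ := hx
  obtain ⟨z, hz, h⟩ := hx'
  exact hX y hy (by rwa [show y + 1 = z by omega])

lemma noConsec_insert_zero {X : Finset ℕ} (hX : noConsec X) (h : 1 ∉ X) :
    noConsec (insert 0 X) := by
  intro x hx hx'
  simp only [Finset.mem_insert] at hx hx'
  rcases hx with rfl | hx
  · exact h (by simpa using hx')
  · exact hX x hx (by simpa using hx')

lemma sum_image_add (X : Finset ℕ) (k : ℕ) :
    ∑ x ∈ X.image (· + k), x = ∑ x ∈ X, x + X.card * k := by
  rw [Finset.sum_image (add_left_injective k).injOn, Finset.sum_add_distrib, Finset.sum_const,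
    smul_eq_mul]

lemma theta_fst_card (Λ : BPair) : (theta Λ).1.card = Λ.1.card + 1 := by
  rw [theta_eq, Finset.card_insert_of_notMem (by simp),
    Finset.card_image_of_injective _ (add_left_injective 2), card_spread]

lemma theta_snd_card (Λ : BPair) : (theta Λ).2.card = Λ.2.card := by
  rw [theta_eq, Finset.card_image_of_injective _ (add_left_injective 1), card_spread]

lemma yDefect_theta (Λ : BPair) : yDefect (theta Λ) = pDefect Λ + 1 := by
  rw [yDefect, theta_fst_card, theta_snd_card, pDefect]
  push_cast
  ring

lemma sum_theta {Λ : BPair} (h : pDefect Λ = 0) :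
    2 * ((∑ x ∈ (theta Λ).1, (x : ℤ)) + ∑ y ∈ (theta Λ).2, (y : ℤ)) =
      2 * pRank Λ + (((theta Λ).1.card + (theta Λ).2.card : ℕ) : ℤ) *
        ((((theta Λ).1.card + (theta Λ).2.card : ℕ) : ℤ) - 1) := by
  have hc : Λ.1.card = Λ.2.card := by
    rw [pDefect] at h
    omega
  have h₁ : ∑ x ∈ (theta Λ).1, x = ∑ a ∈ Λ.1, a + Λ.1.card.choose 2 + Λ.1.card * 2 := by
    rw [theta_eq, Finset.sum_insert (by simp), sum_image_add, sum_spread, card_spread, zero_add]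
  have h₂ : ∑ x ∈ (theta Λ).2, x = ∑ a ∈ Λ.2, a + Λ.2.card.choose 2 + Λ.2.card := by
    rw [theta_eq, sum_image_add, sum_spread, card_spread, mul_one]
  have h₃ : (Λ.2.card.choose 2 : ℤ) * 2 = Λ.2.card * (Λ.2.card - 1) := by
    induction Λ.2.card with
    | zero => simp
    | succ m ih =>
      rw [Nat.choose_succ_succ' _ 1, Nat.choose_one_right]
      push_cast
      linarith
  zify at h₁ h₂
  rw [h₁, h₂, theta_fst_card, theta_snd_card, pRank, bRank, bRank, h, hc]
  push_cast
  norm_num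
  linear_combination 4 * h₃

lemma inYtilde_theta {Λ : BPair} (h : pDefect Λ = 0) : inYtilde (2 * pRank Λ) (theta Λ) := by
  refine ⟨?_, ?_, ?_, ?_, sum_theta h⟩
  · simp +contextual [theta_eq]
  · rw [pDefect] at h
    rw [theta_fst_card, theta_snd_card]
    exact ⟨Λ.2.card, by omega⟩
  · rw [theta_eq]
    exact noConsec_insert_zero (noConsec_image_add (noConsec_spread _) 2) (by simp)
  · rw [theta_eq]
    exact noConsec_image_add (noConsec_spread _) 1

/-- The 1-shift of a pair in the 𝕐-family is in the image of `Θ`. -/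
lemma exists_theta_eq_yShift_one {Q : BPair} (h₀ : ∀ y ∈ Q.2, 0 < y) (h₁ : noConsec Q.1)
    (h₂ : noConsec Q.2) : ∃ Λ, theta Λ = yShift 1 Q := by
  have h : noConsec (insert 0 (Q.2.image (· + 1))) :=
    noConsec_insert_zero (noConsec_image_add h₂ 1) (by simpa using fun h => (h₀ 0 h).false)
  refine ⟨(unspread Q.1, unspread (insert 0 (Q.2.image (· + 1)))), ?_⟩
  rw [theta_eq, spread_unspread h₁, spread_unspread h, yShift, evShift, odShift,
    Finset.image_insert, Finset.image_image]
  rfl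

lemma yShift_one_fst_card (Q : BPair) : (yShift 1 Q).1.card = Q.1.card + 1 := by
  rw [yShift, evShift, Finset.range_one, Finset.image_singleton, Finset.singleton_union,
    Finset.card_insert_of_notMem (by simp), Finset.card_image_of_injective _ (add_left_injective _)]

lemma yShift_one_snd_card (Q : BPair) : (yShift 1 Q).2.card = Q.2.card + 1 := by
  rw [yShift, odShift, Finset.range_one, Finset.image_singleton, Finset.singleton_union,
    Finset.card_insert_of_notMem (by simp), Finset.card_image_of_injective _ (add_left_injective _)]

lemma sum_yShift_one_fst (Q : BPair) :
    ∑ x ∈ (yShift 1 Q).1, x = ∑ x ∈ Q.1, x + Q.1.card * 2 := by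
  rw [yShift, evShift, Finset.range_one, Finset.image_singleton, Finset.singleton_union,
    Finset.sum_insert (by simp), sum_image_add]
  ring

lemma sum_yShift_one_snd (Q : BPair) :
    ∑ y ∈ (yShift 1 Q).2, y = ∑ y ∈ Q.2, y + Q.2.card * 2 + 1 := by
  rw [yShift, odShift, Finset.range_one, Finset.image_singleton, Finset.singleton_union,
    Finset.sum_insert (by simp), sum_image_add]
  ring

/-- `Θ` sends rank-`n` defect-`0` β-pairs into `Ỹ_{2n}` with
defect `1`, is compatible with shifts, and induces a bijection
`𝕍_n^0 → 𝕐_{2n}^1`. -/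
theorem statement_5 (n : ℕ) :
    (∀ Λ : BPair, inV n 0 Λ →
      inYtilde (2 * n) (theta Λ) ∧ yDefect (theta Λ) = 1) ∧
    (∀ Λ : BPair, inV n 0 Λ → theta (pShift 1 Λ) = yShift 1 (theta Λ)) ∧
    (∀ Λ Ξ : BPair, inV n 0 Λ → inV n 0 Ξ →
      (pEquiv Λ Ξ ↔ yEquiv (theta Λ) (theta Ξ))) ∧
    (∀ Q : BPair, inYtilde (2 * n) Q → yDefect Q = 1 →
      ∃ Λ : BPair, inV n 0 Λ ∧ yEquiv (theta Λ) Q) := by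
  refine ⟨?_, fun Λ _ => theta_pShift 1 Λ, ?_, ?_⟩
  · rintro Λ ⟨hr, hd⟩
    exact ⟨hr ▸ inYtilde_theta hd, by rw [yDefect_theta, hd, zero_add]⟩
  · intro Λ Ξ _ _
    simp only [pEquiv, yEquiv, ← theta_pShift, theta_injective.eq_iff]
  · rintro Q ⟨h₀, -, h₁, h₂, hs⟩ hd
    obtain ⟨Λ, hΛ⟩ := exists_theta_eq_yShift_one h₀ h₁ h₂
    have hc₁ := yShift_one_fst_card Q
    have hc₂ := yShift_one_snd_card Q
    have hd' : pDefect Λ = 0 := by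
      have h := yDefect_theta Λ
      rw [hΛ, yDefect, hc₁, hc₂] at h
      rw [yDefect] at hd
      omega
    refine ⟨Λ, ⟨?_, hd'⟩, 1, Or.inr hΛ⟩
    have h := sum_theta hd'
    have hs₁ := sum_yShift_one_fst Q
    have hs₂ := sum_yShift_one_snd Q
    zify at hs₁ hs₂
    rw [hΛ, hc₁, hc₂, hs₁, hs₂] at h
    push_cast at h hs
    linarith

end CSpaper
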